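/- Let q₁,q₂,r₁,r₂ : ℝ² → ℂ be smooth and satisfy the zero-curvature equation ∂ₜU(ζ) − ∂ₓV(ζ) + U(ζ)V(ζ) − V(ζ)U(ζ) = 0 for all ζ ∈ ℂ. Fix ζ₁ ∈ ℂ, ζ₁ ≠ 0, and let Φ = (φ₁,φ₂,φ₃)ᵀ be smooth with φ₁,φ₂ nowhere zero and ∂ₓΦ = U(ζ₁)Φ, ∂ₜΦ = V(ζ₁)Φ. Let Q₂ satisfy ∂ₓQ₂ = q₂ and ∂ₜQ₂ = i∂ₓq₂ + (2/3)(r₁q₁ + r₂q₂)q₂. Define T₁(ζ) = [[aζ, 1, 0], [1, bζ, cζ], [0, dζ, ζ]] with a = −φ₂/(ζ₁φ₁), b = (−φ₁ + ζ₁Q₂φ₃)/(ζ₁φ₂), c = −Q₂, d = −φ₃/φ₂, and the transformed potentials q̂₁ = (q₁φ₂ + q₂φ₃ − 3iζ₁φ₁)φ₂/φ₁², r̂₁ = [(r₁φ₁ + 3iζ₁φ₂)φ₁ + (r₂φ₂ − r₁φ₃)ζ₁Q₂φ₁]/φ₂², r̂₂ = (r₁φ₃ − r₂φ₂)ζ₁φ₁/φ₂²,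 q̂₂ = [(φ₂q₁ + φ₃q₂ − 3iζ₁φ₁)ζ₁Q₂φ₂ − q₂φ₁φ₂]/(ζ₁φ₁²). Then for every ζ ∈ ℂ, ∂ₜT₁(ζ) + T₁(ζ)V(ζ) = V̂(ζ)T₁(ζ), where V̂ is the matrix V with q₁,q₂,r₁,r₂ replaced by q̂₁,q̂₂,r̂₁,r̂₂. -/

import Mathlib

open Complex Matrix

noncomputable section

def pdx (f : ℝ → ℝ → ℂ) : ℝ → ℝ → ℂ := fun x t => deriv (fun x' => f x' t) x

def pdt (f : ℝ → ℝ → ℂ) : ℝ → ℝ → ℂ := fun x t => deriv (fun t' => f x t') t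

def Mpdx (F : ℝ → ℝ → Matrix (Fin 3) (Fin 3) ℂ) : ℝ → ℝ → Matrix (Fin 3) (Fin 3) ℂ :=
  fun x t => Matrix.of fun i j => deriv (fun x' => F x' t i j) x

def Mpdt (F : ℝ → ℝ → Matrix (Fin 3) (Fin 3) ℂ) : ℝ → ℝ → Matrix (Fin 3) (Fin 3) ℂ :=
  fun x t => Matrix.of fun i j => deriv (fun t' => F x t' i j) t

/-- The spatial Lax matrix U(ζ). -/
def Umat (q1 q2 r1 r2 : ℝ → ℝ → ℂ) (ζ : ℂ) (x t : ℝ) : Matrix (Fin 3) (Fin 3) ℂ :=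
  ζ ^ 2 • !![-2 * I, 0, 0; 0, I, 0; 0, 0, I] +
    ζ • !![0, q1 x t, q2 x t; r1 x t, 0, 0; r2 x t, 0, 0]

/-- The temporal Lax matrix V(ζ). -/
def Vmat (q1 q2 r1 r2 : ℝ → ℝ → ℂ) (ζ : ℂ) (x t : ℝ) : Matrix (Fin 3) (Fin 3) ℂ :=
  ζ ^ 4 • !![-9 * I, 0, 0; 0, 0, 0; 0, 0, 0] +
    ζ ^ 3 • !![0, 3 * q1 x t, 3 * q2 x t; 3 * r1 x t, 0, 0; 3 * r2 x t, 0, 0] +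
    ζ ^ 2 • !![-I * (r1 x t * q1 x t + r2 x t * q2 x t), 0, 0;
               0, I * (r1 x t * q1 x t), I * (r1 x t * q2 x t);
               0, I * (r2 x t * q1 x t), I * (r2 x t * q2 x t)] +
    ζ • !![0, I * pdx q1 x t + (2 / 3) * (r1 x t * q1 x t + r2 x t * q2 x t) * q1 x t,
              I * pdx q2 x t + (2 / 3) * (r1 x t * q1 x t + r2 x t * q2 x t) * q2 x t;
           -I * pdx r1 x t + (2 / 3) * (r1 x t * q1 x t + r2 x t * q2 x t) * r1 x t, 0, 0;
           -I * pdx r2 x t + (2 / 3) * (r1 x t * q1 x t + r2 x t * q2 x t) * r2 x t, 0, 0]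

/-- Slices of a jointly smooth function in the first variable have derivative `pdx`. -/
lemma hasDerivAt_pdx {f : ℝ → ℝ → ℂ}
    (hf : ContDiff ℝ (⊤ : ℕ∞) (fun p : ℝ × ℝ => f p.1 p.2)) (x t : ℝ) :
    HasDerivAt (fun x' => f x' t) (pdx f x t) x := by
  have h : ContDiff ℝ (⊤ : ℕ∞) (fun x' : ℝ => f x' t) :=
    hf.comp (contDiff_id.prodMk contDiff_const)
  exact (h.differentiable (by simp) x).hasDerivAt

/-- Slices of a jointly smooth function in the second variable have derivative `pdt`. -/
lemma hasDerivAt_pdt {f : ℝ → ℝ → ℂ}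
    (hf : ContDiff ℝ (⊤ : ℕ∞) (fun p : ℝ × ℝ => f p.1 p.2)) (x t : ℝ) :
    HasDerivAt (fun t' => f x t') (pdt f x t) t := by
  have h : ContDiff ℝ (⊤ : ℕ∞) (fun t' : ℝ => f x t') :=
    hf.comp (contDiff_const.prodMk contDiff_id)
  exact (h.differentiable (by simp) t).hasDerivAt

lemma pdx_eq_of_hasDerivAt {F : ℝ → ℝ → ℂ} {f : ℝ → ℂ} {f' : ℂ} {x t : ℝ}
    (h : HasDerivAt f f' x) (hF : (fun x' => F x' t) = f) : pdx F x t = f' := by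
  rw [pdx, hF, h.deriv]

lemma pdt_eq_of_hasDerivAt {F : ℝ → ℝ → ℂ} {f : ℝ → ℂ} {f' : ℂ} {x t : ℝ}
    (h : HasDerivAt f f' t) (hF : (fun t' => F x t') = f) : pdt F x t = f' := by
  rw [pdt, hF, h.deriv]

set_option maxHeartbeats 4000000 in
/-- the elementary Darboux matrix T₁ intertwines the temporal Lax
matrices V and V̂: ∂ₜT₁ + T₁V = V̂T₁. -/
theorem elementary_darboux_t_equation
    (q1 q2 r1 r2 : ℝ → ℝ → ℂ)
    (hq1 : ContDiff ℝ (⊤ : ℕ∞) (fun p : ℝ × ℝ => q1 p.1 p.2))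
    (hq2 : ContDiff ℝ (⊤ : ℕ∞) (fun p : ℝ × ℝ => q2 p.1 p.2))
    (hr1 : ContDiff ℝ (⊤ : ℕ∞) (fun p : ℝ × ℝ => r1 p.1 p.2))
    (hr2 : ContDiff ℝ (⊤ : ℕ∞) (fun p : ℝ × ℝ => r2 p.1 p.2))
    (hzc : ∀ ζ : ℂ, ∀ x t : ℝ,
      Mpdt (fun x t => Umat q1 q2 r1 r2 ζ x t) x t
        - Mpdx (fun x t => Vmat q1 q2 r1 r2 ζ x t) x t
        + Umat q1 q2 r1 r2 ζ x t * Vmat q1 q2 r1 r2 ζ x t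
        - Vmat q1 q2 r1 r2 ζ x t * Umat q1 q2 r1 r2 ζ x t = 0)
    (ζ₁ : ℂ) (hζ₁ : ζ₁ ≠ 0)
    (φ1 φ2 φ3 : ℝ → ℝ → ℂ)
    (hφ1 : ContDiff ℝ (⊤ : ℕ∞) (fun p : ℝ × ℝ => φ1 p.1 p.2))
    (hφ2 : ContDiff ℝ (⊤ : ℕ∞) (fun p : ℝ × ℝ => φ2 p.1 p.2))
    (hφ3 : ContDiff ℝ (⊤ : ℕ∞) (fun p : ℝ × ℝ => φ3 p.1 p.2))
    (hφ1ne : ∀ x t : ℝ, φ1 x t ≠ 0)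
    (hφ2ne : ∀ x t : ℝ, φ2 x t ≠ 0)
    (hodex : ∀ x t : ℝ,
      ![pdx φ1 x t, pdx φ2 x t, pdx φ3 x t] =
        (Umat q1 q2 r1 r2 ζ₁ x t).mulVec ![φ1 x t, φ2 x t, φ3 x t])
    (hodet : ∀ x t : ℝ,
      ![pdt φ1 x t, pdt φ2 x t, pdt φ3 x t] =
        (Vmat q1 q2 r1 r2 ζ₁ x t).mulVec ![φ1 x t, φ2 x t, φ3 x t])
    (Q2 : ℝ → ℝ → ℂ)
    (hQ2smooth : ContDiff ℝ (⊤ : ℕ∞) (fun p : ℝ × ℝ => Q2 p.1 p.2))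
    (hQ2x : ∀ x t : ℝ, pdx Q2 x t = q2 x t)
    (hQ2t : ∀ x t : ℝ, pdt Q2 x t =
      I * pdx q2 x t + (2 / 3) * (r1 x t * q1 x t + r2 x t * q2 x t) * q2 x t)
    -- entries of the Darboux matrix
    (a b c d : ℝ → ℝ → ℂ)
    (ha : a = fun x t => -(φ2 x t) / (ζ₁ * φ1 x t))
    (hb : b = fun x t => (-(φ1 x t) + ζ₁ * Q2 x t * φ3 x t) / (ζ₁ * φ2 x t))
    (hc : c = fun x t => -(Q2 x t))
    (hd : d = fun x t => -(φ3 x t) / φ2 x t)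
    (T1 : ℂ → ℝ → ℝ → Matrix (Fin 3) (Fin 3) ℂ)
    (hT1 : T1 = fun ζ x t =>
      !![a x t * ζ, 1, 0;
         1, b x t * ζ, c x t * ζ;
         0, d x t * ζ, ζ])
    -- transformed potentials
    (q1h q2h r1h r2h : ℝ → ℝ → ℂ)
    (hq1h : q1h = fun x t =>
      (q1 x t * φ2 x t + q2 x t * φ3 x t - 3 * I * ζ₁ * φ1 x t) * φ2 x t / (φ1 x t) ^ 2)
    (hr1h : r1h = fun x t =>
      ((r1 x t * φ1 x t + 3 * I * ζ₁ * φ2 x t) * φ1 x t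
        + (r2 x t * φ2 x t - r1 x t * φ3 x t) * ζ₁ * Q2 x t * φ1 x t) / (φ2 x t) ^ 2)
    (hr2h : r2h = fun x t =>
      (r1 x t * φ3 x t - r2 x t * φ2 x t) * ζ₁ * φ1 x t / (φ2 x t) ^ 2)
    (hq2h : q2h = fun x t =>
      ((φ2 x t * q1 x t + φ3 x t * q2 x t - 3 * I * ζ₁ * φ1 x t) * ζ₁ * Q2 x t * φ2 x t
        - q2 x t * φ1 x t * φ2 x t) / (ζ₁ * (φ1 x t) ^ 2)) :
    ∀ ζ : ℂ, ∀ x t : ℝ,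
      Mpdt (fun x t => T1 ζ x t) x t + T1 ζ x t * Vmat q1 q2 r1 r2 ζ x t
        = Vmat q1h q2h r1h r2h ζ x t * T1 ζ x t := by
  intro ζ x t
  have h1 := hφ1ne x t
  have h2 := hφ2ne x t
  have e1x := congrFun (hodex x t) 0
  have e2x := congrFun (hodex x t) 1
  have e3x := congrFun (hodex x t) 2
  simp [Umat, Matrix.mulVec, dotProduct, Fin.sum_univ_three] at e1x e2x e3x
  have e1t := congrFun (hodet x t) 0
  have e2t := congrFun (hodet x t) 1
  have e3t := congrFun (hodet x t) 2
  simp [Vmat, Matrix.mulVec, dotProduct, Fin.sum_univ_three] at e1t e2t e3t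
  have dq1 := hasDerivAt_pdx hq1 x t
  have dq2 := hasDerivAt_pdx hq2 x t
  have dr1 := hasDerivAt_pdx hr1 x t
  have dr2 := hasDerivAt_pdx hr2 x t
  have d1 := e1x ▸ hasDerivAt_pdx hφ1 x t
  have d2 := e2x ▸ hasDerivAt_pdx hφ2 x t
  have d3 := e3x ▸ hasDerivAt_pdx hφ3 x t
  have dQ := hQ2x x t ▸ hasDerivAt_pdx hQ2smooth x t
  have t1 := e1t ▸ hasDerivAt_pdt hφ1 x t
  have t2 := e2t ▸ hasDerivAt_pdt hφ2 x t
  have t3 := e3t ▸ hasDerivAt_pdt hφ3 x t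
  have tQ := hQ2t x t ▸ hasDerivAt_pdt hQ2smooth x t
  have hat := pdt_eq_of_hasDerivAt (F := a)
    (t2.neg.div (t1.const_mul ζ₁) (mul_ne_zero hζ₁ h1)) (by rw [ha]; rfl)
  have hbt := pdt_eq_of_hasDerivAt (F := b)
    ((t1.neg.add ((tQ.const_mul ζ₁).mul t3)).div (t2.const_mul ζ₁) (mul_ne_zero hζ₁ h2))
    (by rw [hb]; rfl)
  have hct := pdt_eq_of_hasDerivAt (F := c) tQ.neg (by rw [hc]; rfl)
  have hdt := pdt_eq_of_hasDerivAt (F := d) (t3.neg.div t2 h2) (by rw [hd]; rfl)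
  have hq1hx := pdx_eq_of_hasDerivAt (F := q1h)
    (((((dq1.mul d2).add (dq2.mul d3)).sub (d1.const_mul (3 * I * ζ₁))).mul d2).div
      (d1.pow 2) (pow_ne_zero 2 h1)) (by rw [hq1h]; rfl)
  have hr1hx := pdx_eq_of_hasDerivAt (F := r1h)
    (((((dr1.mul d1).add (d2.const_mul (3 * I * ζ₁))).mul d1).add
      (((((dr2.mul d2).sub (dr1.mul d3)).mul_const ζ₁).mul dQ).mul d1)).div
      (d2.pow 2) (pow_ne_zero 2 h2)) (by rw [hr1h]; rfl)
  have hr2hx := pdx_eq_of_hasDerivAt (F := r2h)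
    (((((dr1.mul d3).sub (dr2.mul d2)).mul_const ζ₁).mul d1).div
      (d2.pow 2) (pow_ne_zero 2 h2)) (by rw [hr2h]; rfl)
  have hq2hx := pdx_eq_of_hasDerivAt (F := q2h)
    ((((((((d2.mul dq1).add (d3.mul dq2)).sub (d1.const_mul (3 * I * ζ₁))).mul_const
      ζ₁).mul dQ).mul d2).sub ((dq2.mul d1).mul d2)).div
      ((d1.pow 2).const_mul ζ₁) (mul_ne_zero hζ₁ (pow_ne_zero 2 h1))) (by rw [hq2h]; rfl)
  simp only [Pi.add_apply, Pi.sub_apply, Pi.mul_apply, Pi.neg_apply, Pi.pow_apply]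
    at hat hbt hdt hq1hx hr1hx hr2hx hq2hx
  have hT : Mpdt (fun x t => T1 ζ x t) x t =
      !![pdt a x t * ζ, 0, 0; 0, pdt b x t * ζ, pdt c x t * ζ; 0, pdt d x t * ζ, 0] := by
    ext i j
    fin_cases i <;> fin_cases j <;> simp [hT1, Mpdt, pdt]
  rw [hT]
  ext i j
  fin_cases i <;> fin_cases j <;>
    simp [hT1, Vmat, Matrix.mul_apply, Fin.sum_univ_three, hat, hbt, hct, hdt,
      hq1hx, hr1hx, hr2hx, hq2hx] <;>
    simp only [ha, hb, hc, hd, hq1h, hq2h, hr1h, hr2h] <;>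
    field_simp <;>
    ring_nf <;>
    simp only [I_sq, I_pow_three] <;>
    ring_nf
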